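/- Let 1<q₁,q₂<∞, 0<r_i<q_i (i=1,2), 1/q=1/q₁+1/q₂, and s≥q. Let u₁,u₂ be weights on ℝ^n satisfying [u₁,u₂]_{q⃗}^s := sup_{Q∈D(ℝ^n)} (⨍_Q u₁^{s/q₁}u₂^{s/q₂})^{1/s} (⨍_Q u₁^{−r₁/(q₁−r₁)})^{(q₁−r₁)/(r₁q₁)} (⨍_Q u₂^{−r₂/(q₂−r₂)})^{(q₂−r₂)/(r₂q₂)} < ∞. Then there exists a>1 with a<min(q₁/r₁,q₂/r₂) such that sup_{Q∈D(ℝ^n)} (⨍_Q u₁^{s/q₁}u₂^{s/q₂})^{1/s} ∏_{i=1}^2 (⨍_Q u_i^{−(r_i/q_i)·(q_i/(a r_i))'})^{1/(r_i(q_i/(a r_i))')} < ∞; in other words, the two-weight condition for v=u₁^{1/q₁}u₂^{1/q₂} and w_i=u_i^{1/q_i} self-improves to the a-bumped condition. -/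

import Mathlib

open MeasureTheory ENNReal

noncomputable section

/-- The dyadic cube `2^{-k}([0,1)^n + m)` in `ℝ^n`. -/
def dyadicCube (n : ℕ) (k : ℤ) (m : Fin n → ℤ) : Set (EuclideanSpace ℝ (Fin n)) :=
  {x | ∀ i, (m i : ℝ) ≤ (2 : ℝ) ^ k * x i ∧ (2 : ℝ) ^ k * x i < (m i : ℝ) + 1}

/-- The concentric triple `3Q` of the dyadic cube with parameters `k, m`. -/
def tripleCube (n : ℕ) (k : ℤ) (m : Fin n → ℤ) : Set (EuclideanSpace ℝ (Fin n)) :=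
  {x | ∀ i, (m i : ℝ) - 1 ≤ (2 : ℝ) ^ k * x i ∧ (2 : ℝ) ^ k * x i < (m i : ℝ) + 2}

/-- `Q` is a dyadic cube. -/
def IsDyadicCube {n : ℕ} (Q : Set (EuclideanSpace ℝ (Fin n))) : Prop :=
  ∃ (k : ℤ) (m : Fin n → ℤ), Q = dyadicCube n k m

/-- A (closed) cube with sides parallel to the axes. -/
def IsCube {n : ℕ} (Q : Set (EuclideanSpace ℝ (Fin n))) : Prop :=
  ∃ (a : EuclideanSpace ℝ (Fin n)) (d : ℝ), 0 < d ∧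
    Q = {x | ∀ i, a i ≤ x i ∧ x i ≤ a i + d}

/-- The average `⨍_Q f` of an `ℝ≥0∞`-valued function. -/
def setAvg {n : ℕ} (Q : Set (EuclideanSpace ℝ (Fin n)))
    (f : EuclideanSpace ℝ (Fin n) → ℝ≥0∞) : ℝ≥0∞ :=
  (volume Q)⁻¹ * ∫⁻ x in Q, f x

/-- The mean `m_Q(b)` of a real-valued function. -/
def setMean {n : ℕ} (Q : Set (EuclideanSpace ℝ (Fin n)))
    (b : EuclideanSpace ℝ (Fin n) → ℝ) : ℝ :=
  (∫ x in Q, b x) / (volume Q).toReal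

/-- The (dyadic) Morrey norm `‖f‖_{M_q^p}` (first exponent `p`, second `q`). -/
def morreyNorm {n : ℕ} (p q : ℝ) (f : EuclideanSpace ℝ (Fin n) → ℝ≥0∞) : ℝ≥0∞ :=
  ⨆ (Q : Set (EuclideanSpace ℝ (Fin n))) (_ : IsDyadicCube Q),
    volume Q ^ (1 / p) * (setAvg Q fun x => f x ^ q) ^ (1 / q)

/-- The weighted Morrey norm `‖f‖_{M_q^p(w)}` (supremum over all cubes). -/
def wMorreyNorm {n : ℕ} (p q : ℝ) (w f : EuclideanSpace ℝ (Fin n) → ℝ≥0∞) : ℝ≥0∞ :=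
  ⨆ (Q : Set (EuclideanSpace ℝ (Fin n))) (_ : IsCube Q),
    (∫⁻ x in Q, w x) ^ (1 / p - 1 / q) * (∫⁻ x in Q, f x ^ q * w x) ^ (1 / q)

/-- The bilinear fractional integral operator `B_α`. -/
def Bop {n : ℕ} (α : ℝ) (f g : EuclideanSpace ℝ (Fin n) → ℝ)
    (x : EuclideanSpace ℝ (Fin n)) : ℝ :=
  ∫ y, f (x - y) * g (x + y) * ‖y‖ ^ (α - (n : ℝ))

/-- The bilinear fractional maximal operator `M_{α,R⃗}`, `R⃗ = (r₁, r₂)`. -/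
def Mop {n : ℕ} (α r₁ r₂ : ℝ) (f g : EuclideanSpace ℝ (Fin n) → ℝ≥0∞)
    (x : EuclideanSpace ℝ (Fin n)) : ℝ≥0∞ :=
  ⨆ (Q : Set (EuclideanSpace ℝ (Fin n))) (_ : IsDyadicCube Q) (_ : x ∈ Q),
    volume Q ^ (α / (n : ℝ)) * (setAvg Q fun y => f y ^ r₁) ^ (1 / r₁) *
      (setAvg Q fun z => g z ^ r₂) ^ (1 / r₂)

/-- The BMO norm `‖b‖_{BMO}` (supremum over all axes-parallel cubes). -/
def bmoNorm {n : ℕ} (b : EuclideanSpace ℝ (Fin n) → ℝ) : ℝ≥0∞ :=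
  ⨆ (Q : Set (EuclideanSpace ℝ (Fin n))) (_ : IsCube Q),
    setAvg Q fun x => ENNReal.ofReal |b x - setMean Q b|

/-- The conjugate exponent `e' = e / (e - 1)`. -/
def conjExp (e : ℝ) : ℝ := e / (e - 1)

abbrev BilinOp (n : ℕ) :=
  (EuclideanSpace ℝ (Fin n) → ℝ) → (EuclideanSpace ℝ (Fin n) → ℝ) →
    EuclideanSpace ℝ (Fin n) → ℝ

/-- The commutator `[b,T]_β` of a bilinear operator; `β = 0` acts on the first slot,
`β = 1` on the second. -/
def commut {n : ℕ} (β : Fin 2) (b : EuclideanSpace ℝ (Fin n) → ℝ) (T : BilinOp n) :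
    BilinOp n := fun f g x =>
  if β = 0 then b x * T f g x - T (fun y => b y * f y) g x
  else b x * T f g x - T f (fun y => b y * g y) x

/-- The iterated commutator `[b⃗,T]_{β⃗} = [b_N,[…,[b₁,T]_{β₁}…]_{β_N}]`. -/
def iterComm {n : ℕ} : (N : ℕ) → (Fin N → EuclideanSpace ℝ (Fin n) → ℝ) →
    (Fin N → Fin 2) → BilinOp n → BilinOp n
  | 0, _, _, T => T
  | (N + 1), b, β, T =>
      commut (β (Fin.last N)) (b (Fin.last N))
        (iterComm N (fun i => b i.castSucc) (fun i => β i.castSucc) T)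

/-- The Muckenhoupt class `A_p`. -/
def IsAp {n : ℕ} (p : ℝ) (w : EuclideanSpace ℝ (Fin n) → ℝ≥0∞) : Prop :=
  ∃ C : ℝ≥0∞, C ≠ ∞ ∧ ∀ Q, IsCube Q →
    setAvg Q w * (setAvg Q fun x => w x ^ (1 - conjExp p)) ^ (p - 1) ≤ C

/-- The class `A_∞ = ⋃_{p>1} A_p`. -/
def IsAinfty {n : ℕ} (w : EuclideanSpace ℝ (Fin n) → ℝ≥0∞) : Prop :=
  ∃ p : ℝ, 1 < p ∧ IsAp p w

/-- The reverse Hölder class `RH_ν`. -/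
def IsRH {n : ℕ} (ν : ℝ) (w : EuclideanSpace ℝ (Fin n) → ℝ≥0∞) : Prop :=
  ∃ C : ℝ≥0∞, C ≠ ∞ ∧ ∀ Q, IsCube Q →
    (setAvg Q fun x => w x ^ ν) ^ (1 / ν) ≤ C * setAvg Q w

/-- The bilinear maximal function associated to the bilinear Hilbert transform. -/
def BHop {n : ℕ} (f g : EuclideanSpace ℝ (Fin n) → ℝ)
    (x : EuclideanSpace ℝ (Fin n)) : ℝ≥0∞ :=
  ⨆ (ρ : ℝ) (_ : 0 < ρ),
    (ENNReal.ofReal ((2 * ρ) ^ n))⁻¹ *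
      ∫⁻ y in {y : EuclideanSpace ℝ (Fin n) | ∀ i, |y i| ≤ ρ},
        ENNReal.ofReal |f (x - y) * g (x + y)|

/-- The factor `(⨍_Q v^{at/(1-t)})^{(1-t)/(at)}`, interpreted as `‖v‖_{L^∞(Q)}` when `t = 1`. -/
def vFactor {n : ℕ} (a t : ℝ) (v : EuclideanSpace ℝ (Fin n) → ℝ≥0∞)
    (Q : Set (EuclideanSpace ℝ (Fin n))) : ℝ≥0∞ :=
  if t = 1 then essSup v (volume.restrict Q)
  else (setAvg Q fun x => v x ^ (a * t / (1 - t))) ^ ((1 - t) / (a * t))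

/-- `sup_Q |Q|^{1/p} (⨍_Q (|f|w₁)^{q₁})^{1/q₁} (⨍_Q (|g|w₂)^{q₂})^{1/q₂}`. -/
def inputNorm {n : ℕ} (p q₁ q₂ : ℝ) (w₁ w₂ : EuclideanSpace ℝ (Fin n) → ℝ≥0∞)
    (f g : EuclideanSpace ℝ (Fin n) → ℝ) : ℝ≥0∞ :=
  ⨆ (Q : Set (EuclideanSpace ℝ (Fin n))) (_ : IsDyadicCube Q),
    volume Q ^ (1 / p) *
      (setAvg Q fun x => (ENNReal.ofReal |f x| * w₁ x) ^ q₁) ^ (1 / q₁) *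
      (setAvg Q fun x => (ENNReal.ofReal |g x| * w₂ x) ^ q₂) ^ (1 / q₂)

/-- `sup_Q |Q|^{1/p} (⨍_Q |f|^{q₁} u₁)^{1/q₁} (⨍_Q |g|^{q₂} u₂)^{1/q₂}`. -/
def inputNormW {n : ℕ} (p q₁ q₂ : ℝ) (u₁ u₂ : EuclideanSpace ℝ (Fin n) → ℝ≥0∞)
    (f g : EuclideanSpace ℝ (Fin n) → ℝ) : ℝ≥0∞ :=
  ⨆ (Q : Set (EuclideanSpace ℝ (Fin n))) (_ : IsDyadicCube Q),
    volume Q ^ (1 / p) *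
      (setAvg Q fun x => ENNReal.ofReal |f x| ^ q₁ * u₁ x) ^ (1 / q₁) *
      (setAvg Q fun x => ENNReal.ofReal |g x| ^ q₂ * u₂ x) ^ (1 / q₂)


lemma mem_dyadicCube_iff {n : ℕ} {k : ℤ} {m : Fin n → ℤ} {x : EuclideanSpace ℝ (Fin n)} :
    x ∈ dyadicCube n k m ↔ ∀ i, ⌊(2 : ℝ) ^ k * x i⌋ = m i := by
  simp only [dyadicCube, Set.mem_ofPred_eq, Int.floor_eq_iff]

lemma mem_dyadicCube_floor {n : ℕ} (k : ℤ) (x : EuclideanSpace ℝ (Fin n)) :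
    x ∈ dyadicCube n k (fun i => ⌊(2 : ℝ) ^ k * x i⌋) :=
  mem_dyadicCube_iff.2 fun _ => rfl

lemma dyadicCube_subset {n : ℕ} {k l : ℤ} (hkl : k ≤ l) {m m' : Fin n → ℤ}
    {x : EuclideanSpace ℝ (Fin n)} (hx : x ∈ dyadicCube n k m) (hx' : x ∈ dyadicCube n l m') :
    dyadicCube n l m' ⊆ dyadicCube n k m := by
  obtain ⟨j, rfl⟩ := Int.le.dest hkl
  have key : ∀ a : ℝ, ⌊(2 : ℝ) ^ k * a⌋ = ⌊(2 : ℝ) ^ (k + j) * a⌋ / ((2 ^ j : ℕ) : ℤ) := by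
    intro a
    rw [← Int.floor_div_natCast, zpow_add₀ two_ne_zero, zpow_natCast]
    congr 1
    push_cast
    field_simp
  intro y hy
  rw [mem_dyadicCube_iff] at *
  intro i
  rw [← hx i, key, key, hy i, hx' i]

lemma dyadicCube_eq_preimage (n : ℕ) (k : ℤ) (m : Fin n → ℤ) :
    dyadicCube n k m = WithLp.ofLp ⁻¹' (Set.univ.pi fun i =>
      Set.Ico ((2 : ℝ) ^ (-k) * m i) ((2 : ℝ) ^ (-k) * (m i + 1))) := by
  have h : (0 : ℝ) < 2 ^ k := by positivity
  ext x
  simp only [dyadicCube, Set.mem_ofPred_eq, Set.mem_preimage, Set.mem_pi, Set.mem_univ,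
    true_implies, Set.mem_Ico, zpow_neg, inv_mul_le_iff₀ h, lt_inv_mul_iff₀ h]

lemma measurableSet_dyadicCube (n : ℕ) (k : ℤ) (m : Fin n → ℤ) :
    MeasurableSet (dyadicCube n k m) := by
  rw [dyadicCube_eq_preimage]
  exact (PiLp.volume_preserving_ofLp (Fin n)).measurable
    (MeasurableSet.univ_pi fun _ => measurableSet_Ico)

lemma volume_dyadicCube (n : ℕ) (k : ℤ) (m : Fin n → ℤ) :
    volume (dyadicCube n k m) = ENNReal.ofReal ((2 : ℝ) ^ (-k)) ^ n := by
  rw [dyadicCube_eq_preimage, (PiLp.volume_preserving_ofLp (Fin n)).measure_preimage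
    (MeasurableSet.univ_pi fun _ => measurableSet_Ico).nullMeasurableSet, Real.volume_pi_Ico]
  simp [mul_add]

namespace IsDyadicCube

variable {n : ℕ} {Q R S : Set (EuclideanSpace ℝ (Fin n))}

lemma measurableSet (hQ : IsDyadicCube Q) : MeasurableSet Q := by
  obtain ⟨k, m, rfl⟩ := hQ
  exact measurableSet_dyadicCube n k m

lemma volume_ne_zero (hQ : IsDyadicCube Q) : volume Q ≠ 0 := by
  obtain ⟨k, m, rfl⟩ := hQ
  rw [volume_dyadicCube]
  exact pow_ne_zero _ (ENNReal.ofReal_pos.2 (by positivity)).ne'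

lemma volume_ne_top (hQ : IsDyadicCube Q) : volume Q ≠ ∞ := by
  obtain ⟨k, m, rfl⟩ := hQ
  rw [volume_dyadicCube]
  exact ENNReal.pow_ne_top ENNReal.ofReal_ne_top

lemma nonempty (hQ : IsDyadicCube Q) : Q.Nonempty :=
  nonempty_of_measure_ne_zero hQ.volume_ne_zero

lemma countable : {Q : Set (EuclideanSpace ℝ (Fin n)) | IsDyadicCube Q}.Countable := by
  refine (Set.countable_range fun p : ℤ × (Fin n → ℤ) => dyadicCube n p.1 p.2).mono ?_
  rintro _ ⟨k, m, rfl⟩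
  exact ⟨(k, m), rfl⟩

lemma subset_or_subset (hQ : IsDyadicCube Q) (hR : IsDyadicCube R)
    {x : EuclideanSpace ℝ (Fin n)} (hx : x ∈ Q) (hx' : x ∈ R) : Q ⊆ R ∨ R ⊆ Q := by
  obtain ⟨k, m, rfl⟩ := hQ
  obtain ⟨l, m', rfl⟩ := hR
  rcases le_total k l with h | h
  · exact Or.inr (dyadicCube_subset h hx hx')
  · exact Or.inl (dyadicCube_subset h hx' hx)

/-- Every proper dyadic subcube of `Q` has a dyadic parent inside `Q`. -/
lemma exists_parent (hQ : IsDyadicCube Q) (hR : IsDyadicCube R) (hRQ : R ⊆ Q) (hne : R ≠ Q) :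
    ∃ P, IsDyadicCube P ∧ R ⊆ P ∧ P ⊆ Q ∧ volume P = 2 ^ n * volume R := by
  obtain ⟨x, hx⟩ := hR.nonempty
  obtain ⟨k, m, rfl⟩ := hQ
  obtain ⟨l, m', rfl⟩ := hR
  have hkl : k + 1 ≤ l := by
    by_contra! h
    exact hne (hRQ.antisymm (dyadicCube_subset (by lia) hx (hRQ hx)))
  have hxP := mem_dyadicCube_floor (l - 1) x
  refine ⟨_, ⟨l - 1, _, rfl⟩, dyadicCube_subset (by lia) hxP hx,
    dyadicCube_subset (by lia) (hRQ hx) hxP, ?_⟩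
  rw [volume_dyadicCube, volume_dyadicCube, ← mul_pow, neg_sub, sub_eq_add_neg,
    zpow_one_add₀ two_ne_zero, ENNReal.ofReal_mul zero_le_two]
  simp

/-- Dyadic cubes form a basis of neighbourhoods, even when restricted to subcubes of `Q`. -/
lemma exists_subset_isOpen (hQ : IsDyadicCube Q) {U : Set (EuclideanSpace ℝ (Fin n))}
    (hU : IsOpen U) {x : EuclideanSpace ℝ (Fin n)} (hxU : x ∈ U) (hxQ : x ∈ Q) :
    ∃ R, IsDyadicCube R ∧ R ⊆ Q ∧ R ⊆ U ∧ x ∈ R := by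
  obtain ⟨k, m, rfl⟩ := hQ
  have hV : IsOpen (WithLp.toLp 2 ⁻¹' U : Set (Fin n → ℝ)) :=
    hU.preimage (PiLp.continuous_toLp 2 _)
  obtain ⟨ε, hε, hball⟩ := Metric.isOpen_iff.1 hV (WithLp.ofLp x) hxU
  obtain ⟨j, hj⟩ := exists_pow_lt_of_lt_one hε (by norm_num : (1 / 2 : ℝ) < 1)
  set l : ℤ := max k j with hl
  have hle : ((2 : ℝ) ^ l)⁻¹ < ε := by
    refine lt_of_le_of_lt ?_ hj
    rw [one_div, inv_pow]
    refine inv_anti₀ (by positivity) ?_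
    rw [← zpow_natCast]
    exact zpow_le_zpow_right₀ one_le_two (le_max_right _ _)
  have hxR := mem_dyadicCube_floor l x
  refine ⟨_, ⟨l, _, rfl⟩, dyadicCube_subset (le_max_left _ _) hxQ hxR, ?_, hxR⟩
  intro y hy
  refine hball (?_ : WithLp.ofLp y ∈ _)
  rw [Metric.mem_ball, dist_pi_lt_iff hε]
  intro i
  refine lt_trans ?_ hle
  have hp : (0 : ℝ) < 2 ^ l := by positivity
  obtain ⟨hx₁, hx₂⟩ := hxR i
  obtain ⟨hy₁, hy₂⟩ := hy i
  rw [Real.dist_eq, ← one_div, lt_div_iff₀' hp, ← abs_of_pos hp, ← abs_mul, mul_sub, abs_lt]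
  constructor <;> linarith

/-- In a family of dyadic subcubes of `Q`, every cube lies in a maximal one. -/
lemma exists_maximal (hQ : IsDyadicCube Q) {F : Set (Set (EuclideanSpace ℝ (Fin n)))}
    (hF : ∀ R ∈ F, IsDyadicCube R ∧ R ⊆ Q) (hR : R ∈ F) :
    ∃ S, R ⊆ S ∧ Maximal (· ∈ F) S := by
  classical
  obtain ⟨k, m, rfl⟩ := hQ
  have hgen : ∀ T ∈ F, ∃ (j : ℕ) (m' : Fin n → ℤ), T = dyadicCube n (k + j) m' := by
    intro T hT
    obtain ⟨⟨l, m', rfl⟩, hTQ⟩ := hF T hT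
    rcases le_total k l with h | h
    · obtain ⟨j, rfl⟩ := Int.le.dest h
      exact ⟨j, m', rfl⟩
    · obtain ⟨x, hx⟩ := IsDyadicCube.nonempty ⟨l, m', rfl⟩
      refine ⟨0, m, ?_⟩
      simpa using hTQ.antisymm (dyadicCube_subset h hx (hTQ hx))
  obtain ⟨x, hx⟩ := (hF R hR).1.nonempty
  have hex : ∃ j : ℕ, ∃ m' : Fin n → ℤ, dyadicCube n (k + j) m' ∈ F ∧
      R ⊆ dyadicCube n (k + j) m' := by
    obtain ⟨j, m', rfl⟩ := hgen R hR
    exact ⟨j, m', hR, subset_rfl⟩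
  obtain ⟨m', hS, hRS⟩ := Nat.find_spec hex
  refine ⟨_, hRS, hS, fun T hT hST => ?_⟩
  obtain ⟨j, m'', rfl⟩ := hgen T hT
  have := Nat.find_min' hex ⟨m'', hT, hRS.trans hST⟩
  exact dyadicCube_subset (by gcongr) (hRS hx) (hST (hRS hx))

/-- The maximal members of a family of dyadic cubes are pairwise disjoint. -/
lemma pairwise_disjoint_maximal {F : Set (Set (EuclideanSpace ℝ (Fin n)))}
    (hF : ∀ R ∈ F, IsDyadicCube R) : {S | Maximal (· ∈ F) S}.Pairwise Disjoint := by
  intro S hS T hT hne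
  rw [Set.disjoint_left]
  intro x hxS hxT
  rcases (hF S hS.prop).subset_or_subset (hF T hT.prop) hxS hxT with h | h
  · exact hne (hS.eq_of_le hT.prop h)
  · exact hne (hT.eq_of_le hS.prop h).symm

lemma measure_sUnion_le {M : Set (Set (EuclideanSpace ℝ (Fin n)))} (hM : ∀ R ∈ M, IsDyadicCube R)
    (hd : M.Pairwise Disjoint) {μ ν : Measure (EuclideanSpace ℝ (Fin n))}
    (h : ∀ R ∈ M, μ R ≤ ν R) : μ (⋃₀ M) ≤ ν (⋃₀ M) := by
  have hc : M.Countable := IsDyadicCube.countable.mono hM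
  rw [measure_sUnion hc hd fun s hs => (hM s hs).measurableSet,
    measure_sUnion hc hd fun s hs => (hM s hs).measurableSet]
  exact ENNReal.tsum_le_tsum fun s => h s s.2

lemma sUnion_maximal (hQ : IsDyadicCube Q) {F : Set (Set (EuclideanSpace ℝ (Fin n)))}
    (hF : ∀ R ∈ F, IsDyadicCube R ∧ R ⊆ Q) : ⋃₀ {S | Maximal (· ∈ F) S} = ⋃₀ F := by
  refine (Set.sUnion_subset_sUnion fun S hS => hS.prop).antisymm ?_
  rintro x ⟨R, hR, hx⟩
  obtain ⟨S, hRS, hS⟩ := hQ.exists_maximal hF hR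
  exact ⟨S, hS, hRS hx⟩

/-- An inequality between measures on each member of a family of dyadic subcubes of `Q` passes to
the union of the family. -/
lemma measure_sUnion_le_of_subset (hQ : IsDyadicCube Q)
    {F : Set (Set (EuclideanSpace ℝ (Fin n)))} (hF : ∀ R ∈ F, IsDyadicCube R ∧ R ⊆ Q)
    {μ ν : Measure (EuclideanSpace ℝ (Fin n))}
    (h : ∀ R ∈ F, μ R ≤ ν R) : μ (⋃₀ F) ≤ ν (⋃₀ F) := by
  rw [← hQ.sUnion_maximal hF]
  exact measure_sUnion_le (fun R hR => (hF R hR.prop).1)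
    (pairwise_disjoint_maximal fun R hR => (hF R hR).1) fun R hR => h R hR.prop

end IsDyadicCube

section ReverseHolder

variable {n : ℕ} {Q : Set (EuclideanSpace ℝ (Fin n))} {t : ℝ≥0∞}

/-- The dyadic subcubes of `Q` on which `ν` has density larger than `t`. -/
def bigCubes (Q : Set (EuclideanSpace ℝ (Fin n))) (ν : Measure (EuclideanSpace ℝ (Fin n)))
    (t : ℝ≥0∞) : Set (Set (EuclideanSpace ℝ (Fin n))) :=
  {R | IsDyadicCube R ∧ R ⊆ Q ∧ t * volume R < ν R}

/-- The level set `{M > t}` of the dyadic maximal function of `ν` localized to `Q`. -/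
def maximalLevel (Q : Set (EuclideanSpace ℝ (Fin n))) (ν : Measure (EuclideanSpace ℝ (Fin n)))
    (t : ℝ≥0∞) : Set (EuclideanSpace ℝ (Fin n)) :=
  ⋃₀ bigCubes Q ν t

lemma measurableSet_maximalLevel (ν : Measure (EuclideanSpace ℝ (Fin n))) :
    MeasurableSet (maximalLevel Q ν t) :=
  MeasurableSet.sUnion (IsDyadicCube.countable.mono fun _ hR => hR.1)
    fun _ hR => hR.1.measurableSet

lemma maximalLevel_subset (ν : Measure (EuclideanSpace ℝ (Fin n))) : maximalLevel Q ν t ⊆ Q :=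
  Set.sUnion_subset fun _ hR => hR.2.1

lemma bigCubes_anti (ν : Measure (EuclideanSpace ℝ (Fin n))) : Antitone (bigCubes Q ν) :=
  fun _ _ h _ hR => ⟨hR.1, hR.2.1, lt_of_le_of_lt (by gcongr) hR.2.2⟩

/-- Lebesgue differentiation along dyadic cubes, in the form needed here. -/
lemma ae_le_of_notMem_maximalLevel (hQ : IsDyadicCube Q) {σ : EuclideanSpace ℝ (Fin n) → ℝ≥0∞}
    (hσ : Measurable σ) (ht : t ≠ ∞) :
    ∀ᵐ x, x ∈ Q → x ∉ maximalLevel Q (volume.withDensity σ) t → σ x ≤ t := by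
  set Ω := maximalLevel Q (volume.withDensity σ) t
  set G := (Q \ Ω) ∩ {x | t < σ x} with hG
  have hGm : MeasurableSet G := (hQ.measurableSet.diff (measurableSet_maximalLevel _)).inter
    (measurableSet_lt measurable_const hσ)
  suffices h : volume G = 0 by
    filter_upwards [measure_eq_zero_iff_ae_notMem.1 h] with x hx hxQ hxΩ
    by_contra! hlt
    exact hx ⟨⟨hxQ, hxΩ⟩, hlt⟩
  by_contra hG0
  have hreg := Measure.OuterRegular.smul (volume : Measure (EuclideanSpace ℝ (Fin n))) ht
  have hle : (volume.withDensity σ) G ≤ (t • volume : Measure (EuclideanSpace ℝ (Fin n))) G := by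
    refine _root_.le_of_forall_pos_le_add fun ε hε => ?_
    obtain ⟨U, hGU, hU, hUle⟩ := G.exists_isOpen_le_add (t • volume) hε.ne'
    refine le_trans ?_ hUle
    set F := {R : Set (EuclideanSpace ℝ (Fin n)) |
      IsDyadicCube R ∧ R ⊆ Q ∧ R ⊆ U ∧ (R ∩ G).Nonempty}
    have hGF : G ⊆ ⋃₀ F := by
      intro x hx
      obtain ⟨R, hR, hRQ, hRU, hxR⟩ := hQ.exists_subset_isOpen hU (hGU hx) hx.1.1
      exact ⟨R, ⟨hR, hRQ, hRU, x, hxR, hx⟩, hxR⟩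
    calc (volume.withDensity σ) G ≤ (volume.withDensity σ) (⋃₀ F) := measure_mono hGF
      _ ≤ (t • volume : Measure (EuclideanSpace ℝ (Fin n))) (⋃₀ F) := by
        refine hQ.measure_sUnion_le_of_subset (fun R hR => ⟨hR.1, hR.2.1⟩) ?_
        rintro R ⟨hR, hRQ, -, x, hxR, hxG⟩
        by_contra! hlt
        exact hxG.1.2 ⟨R, ⟨hR, hRQ, hlt⟩, hxR⟩
      _ ≤ _ := measure_mono (Set.sUnion_subset fun R hR => hR.2.2.1)
  have hfin : ∫⁻ _ in G, t ≠ ∞ := by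
    rw [setLIntegral_const]
    exact ENNReal.mul_ne_top ht
      (measure_ne_top_of_subset (fun x hx => hx.1.1) hQ.volume_ne_top)
  have hlt := setLIntegral_strict_mono hGm hG0 hσ hfin (ae_of_all _ fun x hx => hx.2)
  rw [withDensity_apply _ hGm] at hle
  rw [setLIntegral_const] at hlt
  exact hlt.not_ge hle

/-- The `A_∞` condition on `Q` with half-size sets and constant `η`. -/
def IsDyadicAinftyOn (Q : Set (EuclideanSpace ℝ (Fin n)))
    (ν : Measure (EuclideanSpace ℝ (Fin n))) (η : ℝ≥0∞) : Prop :=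
  ∀ R, IsDyadicCube R → R ⊆ Q → ∀ E ⊆ R, MeasurableSet E → 2 * volume E ≤ volume R →
    ν E ≤ η * ν R

lemma measure_maximalLevel_le (hn : 0 < n) (hQ : IsDyadicCube Q)
    {ν : Measure (EuclideanSpace ℝ (Fin n))} {η : ℝ≥0∞} (hν : IsDyadicAinftyOn Q ν η)
    (ht0 : t ≠ 0) (ht : t ≠ ∞) (hQt : ν Q ≤ t * volume Q) :
    ν (maximalLevel Q ν (2 ^ (n + 1) * t)) ≤ η * ν (maximalLevel Q ν t) := by
  set Ω := maximalLevel Q ν (2 ^ (n + 1) * t)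
  have hle : t ≤ 2 ^ (n + 1) * t := le_mul_of_one_le_left' (one_le_pow₀ one_le_two)
  have hΩm : MeasurableSet Ω := measurableSet_maximalLevel ν
  have hΩ : Ω ⊆ maximalLevel Q ν t := Set.sUnion_subset_sUnion (bigCubes_anti ν hle)
  have hF : ∀ R ∈ bigCubes Q ν t, IsDyadicCube R ∧ R ⊆ Q := fun R hR => ⟨hR.1, hR.2.1⟩
  suffices h : ∀ S, Maximal (· ∈ bigCubes Q ν t) S → ν.restrict Ω S ≤ (η • ν) S by
    have := IsDyadicCube.measure_sUnion_le (M := {S | Maximal (· ∈ bigCubes Q ν t) S})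
      (fun R hR => (hF R hR.prop).1)
      (IsDyadicCube.pairwise_disjoint_maximal fun R hR => (hF R hR).1) h
    rw [hQ.sUnion_maximal hF] at this
    change ν.restrict Ω (maximalLevel Q ν t) ≤ (η • ν) (maximalLevel Q ν t) at this
    rwa [Measure.restrict_apply (measurableSet_maximalLevel ν),
      Set.inter_eq_right.2 hΩ] at this
  intro S hS
  obtain ⟨hSd, hSQ, hSt⟩ := hS.prop
  rw [Measure.restrict_apply hSd.measurableSet]
  refine hν S hSd hSQ _ Set.inter_subset_left (hSd.measurableSet.inter hΩm) ?_
  have hSne : S ≠ Q := by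
    rintro rfl
    exact hSt.not_ge hQt
  obtain ⟨P, hP, hSP, hPQ, hPvol⟩ := hQ.exists_parent hSd hSQ hSne
  have hPt : ν P ≤ t * volume P := by
    by_contra! hlt
    have hPS : P = S := (hS.eq_of_le ⟨hP, hPQ, hlt⟩ hSP).symm
    rw [hPS] at hPvol
    have h1 : (1 : ℝ≥0∞) < 2 ^ n := one_lt_pow₀ ENNReal.one_lt_two hn.ne'
    have := ENNReal.mul_lt_mul_left hSd.volume_ne_zero hSd.volume_ne_top h1
    rw [one_mul, ← hPvol] at this
    exact this.false
  set F := {R | R ∈ bigCubes Q ν (2 ^ (n + 1) * t) ∧ R ⊆ S} with hFdef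
  have hsub : S ∩ Ω ⊆ ⋃₀ F := by
    rintro x ⟨hxS, R, hR, hxR⟩
    refine ⟨R, ⟨hR, ?_⟩, hxR⟩
    rcases hSd.subset_or_subset hR.1 hxS hxR with h | h
    · exact (hS.eq_of_le (bigCubes_anti ν hle hR) h).ge
    · exact h
  have hweak : ((2 ^ (n + 1) * t) • volume : Measure (EuclideanSpace ℝ (Fin n))) (⋃₀ F)
      ≤ ν (⋃₀ F) :=
    hQ.measure_sUnion_le_of_subset (fun R hR => ⟨hR.1.1, hR.1.2.1⟩) fun R hR => hR.1.2.2.le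
  have hc0 : 2 ^ n * t ≠ 0 := mul_ne_zero (by simp) ht0
  have hct : 2 ^ n * t ≠ ∞ := ENNReal.mul_ne_top (by simp) ht
  rw [← ENNReal.mul_le_mul_iff_right hc0 hct]
  calc 2 ^ n * t * (2 * volume (S ∩ Ω)) ≤ 2 ^ n * t * (2 * volume (⋃₀ F)) := by gcongr
    _ = 2 ^ (n + 1) * t * volume (⋃₀ F) := by ring
    _ ≤ ν (⋃₀ F) := hweak
    _ ≤ ν P := measure_mono ((Set.sUnion_subset fun R hR => hR.2).trans hSP)
    _ ≤ t * volume P := hPt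
    _ = 2 ^ n * t * volume S := by rw [hPvol]; ring

/-- The constant in the reverse Hölder inequality. -/
def rhConst (n : ℕ) (η : ℝ≥0∞) (ε : ℝ) : ℝ≥0∞ :=
  1 + ∑' k : ℕ, ((2 ^ (n + 1)) ^ (k + 1)) ^ ε * η ^ k

lemma rhConst_ne_top {η : ℝ≥0∞} {ε : ℝ} (h : ((2 : ℝ≥0∞) ^ (n + 1)) ^ ε * η < 1) (hε : 0 ≤ ε) :
    rhConst n η ε ≠ ∞ := by
  set A : ℝ≥0∞ := 2 ^ (n + 1)
  have hterm : ∀ k : ℕ, (A ^ (k + 1)) ^ ε * η ^ k = A ^ ε * (A ^ ε * η) ^ k := by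
    intro k
    have : (A ^ (k + 1)) ^ ε = (A ^ ε) ^ (k + 1) := by
      rw [← ENNReal.rpow_natCast, ← ENNReal.rpow_natCast, ← ENNReal.rpow_mul, ← ENNReal.rpow_mul,
        mul_comm]
    rw [this]
    ring
  change 1 + ∑' k : ℕ, (A ^ (k + 1)) ^ ε * η ^ k ≠ ∞
  rw [tsum_congr hterm, ENNReal.tsum_mul_left, ENNReal.tsum_geometric]
  refine ENNReal.add_ne_top.2 ⟨ENNReal.one_ne_top, ENNReal.mul_ne_top
    (ENNReal.rpow_ne_top_of_nonneg hε (by simp [A])) (ENNReal.inv_ne_top.2 ?_)⟩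
  exact (tsub_pos_of_lt h).ne'

/-- Reverse Hölder inequality for dyadic `A_∞` weights. -/
lemma setAvg_rpow_le (hn : 0 < n) (hQ : IsDyadicCube Q) {σ : EuclideanSpace ℝ (Fin n) → ℝ≥0∞}
    (hσ : Measurable σ) {η : ℝ≥0∞} (hν : IsDyadicAinftyOn Q (volume.withDensity σ) η)
    (h0 : setAvg Q σ ≠ 0) (hfin : setAvg Q σ ≠ ∞) {ε : ℝ} (hε : 0 < ε) :
    setAvg Q (fun x => σ x ^ (1 + ε)) ≤ rhConst n η ε * setAvg Q σ ^ (1 + ε) := by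
  set ν := volume.withDensity σ with hνdef
  set t := setAvg Q σ with htdef
  set A : ℝ≥0∞ := 2 ^ (n + 1) with hA
  have hA1 : 1 ≤ A := one_le_pow₀ one_le_two
  have hAtop : A ≠ ∞ := by simp [hA]
  have hA0 : A ≠ 0 := by simp [hA]
  have hνQ : ν Q = t * volume Q := by
    rw [hνdef, withDensity_apply _ hQ.measurableSet, htdef, setAvg, mul_comm, ← mul_assoc,
      ENNReal.mul_inv_cancel hQ.volume_ne_zero hQ.volume_ne_top, one_mul]
  set Ω : ℕ → Set (EuclideanSpace ℝ (Fin n)) := fun k => maximalLevel Q ν (A ^ k * t) with hΩ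
  have hΩm : ∀ k, MeasurableSet (Ω k) := fun k => measurableSet_maximalLevel ν
  have hAkt : ∀ k : ℕ, A ^ k * t ≠ ∞ := fun k => ENNReal.mul_ne_top (by simp [hAtop]) hfin
  have hdecay : ∀ k, ν (Ω k) ≤ η ^ k * ν Q := by
    intro k
    induction k with
    | zero => simpa using measure_mono (maximalLevel_subset ν)
    | succ k ih =>
      have := measure_maximalLevel_le (t := A ^ k * t) hn hQ hν (mul_ne_zero (by simp [hA0]) h0)
        (hAkt k) (by
          rw [hνQ]
          gcongr
          exact le_mul_of_one_le_left' (one_le_pow₀ hA1))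
      rw [← mul_assoc, ← pow_succ'] at this
      calc ν (Ω (k + 1)) ≤ η * ν (Ω k) := this
        _ ≤ η * (η ^ k * ν Q) := by gcongr
        _ = _ := by ring
  have hpt : ∀ᵐ x, x ∈ Q → σ x ^ ε ≤
      t ^ ε * (1 + ∑' k, (Ω k).indicator (fun _ => (A ^ (k + 1)) ^ ε) x) := by
    have hall := ae_all_iff.2 fun k : ℕ => ae_le_of_notMem_maximalLevel hQ hσ (hAkt k)
    filter_upwards [hall] with x hx hxQ
    by_cases hmem : ∃ k, x ∉ Ω k
    · classical
      have hspec : x ∉ Ω (Nat.find hmem) := Nat.find_spec hmem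
      have hσx := hx _ hxQ hspec
      rcases hk : Nat.find hmem with _ | k
      · rw [hk, pow_zero, one_mul] at hσx
        calc σ x ^ ε ≤ t ^ ε * 1 := by rw [mul_one]; gcongr
          _ ≤ _ := by gcongr; exact le_self_add
      · have hxk : x ∈ Ω k := by
          by_contra hc
          have := Nat.find_min' hmem hc
          rw [hk] at this
          lia
        rw [hk] at hσx
        calc σ x ^ ε ≤ (A ^ (k + 1) * t) ^ ε := by gcongr
          _ = t ^ ε * (Ω k).indicator (fun _ => (A ^ (k + 1)) ^ ε) x := by
            rw [Set.indicator_of_mem hxk, ENNReal.mul_rpow_of_nonneg _ _ hε.le, mul_comm]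
          _ ≤ _ := by
            gcongr
            exact (ENNReal.le_tsum (f := fun k => (Ω k).indicator
              (fun _ => (A ^ (k + 1)) ^ ε) x) k).trans le_add_self
    · push Not at hmem
      have htop : ∑' k, (Ω k).indicator (fun _ => (A ^ (k + 1)) ^ ε) x = ∞ := by
        refine top_unique ?_
        rw [← ENNReal.tsum_const_eq_top_of_ne_zero (α := ℕ) one_ne_zero]
        refine ENNReal.tsum_le_tsum fun k => ?_
        rw [Set.indicator_of_mem (hmem k)]
        exact ENNReal.one_le_rpow (one_le_pow₀ hA1) hε
      rw [htop, add_top, ENNReal.mul_top]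
      · exact le_top
      · exact (ENNReal.rpow_pos (pos_iff_ne_zero.2 h0) hfin).ne'
  have hmeas : Measurable fun x => ∑' k, (Ω k).indicator (fun _ => (A ^ (k + 1)) ^ ε) x :=
    Measurable.tsum fun k => measurable_const.indicator (hΩm k)
  have hmain : ∫⁻ x in Q, σ x ^ (1 + ε) ≤ rhConst n η ε * (t ^ ε * ν Q) := by
    calc ∫⁻ x in Q, σ x ^ (1 + ε) = ∫⁻ x in Q, σ x * σ x ^ ε := by
          simp_rw [ENNReal.rpow_add_of_nonneg _ _ zero_le_one hε.le, ENNReal.rpow_one]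
      _ ≤ ∫⁻ x in Q, σ x *
          (t ^ ε * (1 + ∑' k, (Ω k).indicator (fun _ => (A ^ (k + 1)) ^ ε) x)) := by
        refine setLIntegral_mono_ae' hQ.measurableSet ?_
        filter_upwards [hpt] with x hx hxQ
        gcongr
        exact hx hxQ
      _ = ∫⁻ x in Q, (t ^ ε * (1 + ∑' k, (Ω k).indicator (fun _ => (A ^ (k + 1)) ^ ε) x)) ∂ν := by
        rw [hνdef, setLIntegral_withDensity_eq_setLIntegral_mul _ hσ _ hQ.measurableSet]
        · rfl
        · exact (hmeas.const_add 1).const_mul _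
      _ = t ^ ε * (ν Q + ∑' k : ℕ, (A ^ (k + 1)) ^ ε * ν (Ω k)) := by
        rw [lintegral_const_mul _ (hmeas.const_add 1), lintegral_add_left measurable_const,
          lintegral_tsum fun k => (measurable_const.indicator (hΩm k)).aemeasurable]
        congr 2
        · simp
        · refine tsum_congr fun k => ?_
          rw [lintegral_indicator (hΩm k), Measure.restrict_restrict (hΩm k), setLIntegral_const,
            Set.inter_eq_left.2 (maximalLevel_subset ν)]
      _ ≤ t ^ ε * (ν Q + ∑' k : ℕ, (A ^ (k + 1)) ^ ε * (η ^ k * ν Q)) := by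
        gcongr with k
        exact hdecay k
      _ = rhConst n η ε * (t ^ ε * ν Q) := by
        simp_rw [← mul_assoc]
        rw [ENNReal.tsum_mul_right, rhConst]
        ring
  calc setAvg Q (fun x => σ x ^ (1 + ε))
      ≤ (volume Q)⁻¹ * (rhConst n η ε * (t ^ ε * ν Q)) := by
        rw [setAvg]; gcongr
    _ = rhConst n η ε * t ^ (1 + ε) * ((volume Q)⁻¹ * volume Q) := by
        rw [hνQ, ENNReal.rpow_add_of_nonneg _ _ zero_le_one hε.le, ENNReal.rpow_one]
        ring
    _ = _ := by
        rw [ENNReal.inv_mul_cancel hQ.volume_ne_zero hQ.volume_ne_top, mul_one]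

end ReverseHolder

section Holder

variable {n : ℕ} {Q : Set (EuclideanSpace ℝ (Fin n))}

lemma setAvg_mul_volume (hQ : IsDyadicCube Q) (f : EuclideanSpace ℝ (Fin n) → ℝ≥0∞) :
    setAvg Q f * volume Q = ∫⁻ x in Q, f x := by
  rw [setAvg, mul_right_comm, ENNReal.inv_mul_cancel hQ.volume_ne_zero hQ.volume_ne_top, one_mul]

lemma lintegral_ne_top_of_setAvg_ne_top (hQ : IsDyadicCube Q)
    {f : EuclideanSpace ℝ (Fin n) → ℝ≥0∞} (h : setAvg Q f ≠ ∞) : ∫⁻ x in Q, f x ≠ ∞ := by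
  rw [← setAvg_mul_volume hQ]
  exact ENNReal.mul_ne_top h hQ.volume_ne_top

lemma setAvg_rpow_eq_zero (hQ : IsDyadicCube Q) {f : EuclideanSpace ℝ (Fin n) → ℝ≥0∞}
    (hf : Measurable f) (h : setAvg Q f = 0) {c : ℝ} (hc : 0 < c) :
    setAvg Q (fun x => f x ^ c) = 0 := by
  have h0 : ∫⁻ x in Q, f x = 0 := by rw [← setAvg_mul_volume hQ, h, zero_mul]
  have h1 : ∫⁻ x in Q, f x ^ c = 0 := by
    rw [lintegral_eq_zero_iff (hf.pow_const c)]
    filter_upwards [(lintegral_eq_zero_iff hf).1 h0] with x hx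
    simp only [Pi.zero_apply] at hx ⊢
    rw [hx, ENNReal.zero_rpow_of_pos hc]
  rw [setAvg, h1, mul_zero]

lemma setLIntegral_one_le_of_holder {E : Set (EuclideanSpace ℝ (Fin n))} (hE : MeasurableSet E)
    {f σ τ : EuclideanSpace ℝ (Fin n) → ℝ≥0∞} (hf : Measurable f) (hσ : Measurable σ)
    (hτ : Measurable τ) {p₀ p₁ p₂ : ℝ} (hp₀ : 0 < p₀) (hp₁ : 0 < p₁) (hp₂ : 0 < p₂)
    (hp : p₀ + p₁ + p₂ = 1) (h : ∀ᵐ x, x ∈ E → 1 ≤ f x ^ p₀ * σ x ^ p₁ * τ x ^ p₂) :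
    volume E ≤ (∫⁻ x in E, f x) ^ p₀ * (∫⁻ x in E, σ x) ^ p₁ * (∫⁻ x in E, τ x) ^ p₂ := by
  have holder := ENNReal.lintegral_prod_norm_pow_le (μ := volume.restrict E) Finset.univ
    (f := ![f, σ, τ]) (p := ![p₀, p₁, p₂])
    (by
      intro i _
      fin_cases i
      exacts [hf.aemeasurable, hσ.aemeasurable, hτ.aemeasurable])
    (by simpa [Fin.sum_univ_three] using hp)
    (by
      intro i _
      fin_cases i
      exacts [hp₀.le, hp₁.le, hp₂.le])
  simp only [Fin.prod_univ_three, Matrix.cons_val] at holder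
  calc volume E = ∫⁻ _ in E, 1 := by rw [setLIntegral_const, one_mul]
    _ ≤ ∫⁻ x in E, f x ^ p₀ * σ x ^ p₁ * τ x ^ p₂ := setLIntegral_mono_ae' hE h
    _ ≤ _ := holder

/-- The `A_∞` constant obtained from a Muckenhoupt-type product condition. -/
def ainftyConst (K : ℝ≥0∞) (p : ℝ) : ℝ≥0∞ :=
  (2 * K) ^ p⁻¹ / ((2 * K) ^ p⁻¹ + 1)

lemma ainftyConst_lt_one {K : ℝ≥0∞} (hK : K ≠ ∞) {p : ℝ} (hp : 0 < p) : ainftyConst K p < 1 := by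
  have hL : (2 * K) ^ p⁻¹ ≠ ∞ :=
    ENNReal.rpow_ne_top_of_nonneg (by positivity) (ENNReal.mul_ne_top (by simp) hK)
  rw [ainftyConst, ENNReal.div_lt_iff (by simp) (by simp [hL]), one_mul]
  exact ENNReal.lt_add_right hL one_ne_zero

/-- A Muckenhoupt-type product condition makes each of its dual weights an `A_∞` weight. -/
lemma isDyadicAinftyOn_of_product
    {f σ τ : EuclideanSpace ℝ (Fin n) → ℝ≥0∞} (hf : Measurable f) (hσ : Measurable σ)
    (hτ : Measurable τ) {p₀ p₁ p₂ : ℝ} (hp₀ : 0 < p₀) (hp₁ : 0 < p₁) (hp₂ : 0 < p₂)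
    (hp : p₀ + p₁ + p₂ = 1) (h : ∀ᵐ x, x ∈ Q → 1 ≤ f x ^ p₀ * σ x ^ p₁ * τ x ^ p₂)
    {K : ℝ≥0∞} (hK : ∀ R, IsDyadicCube R →
      setAvg R f ^ p₀ * setAvg R σ ^ p₁ * setAvg R τ ^ p₂ ≤ K) (hKtop : K ≠ ∞) :
    IsDyadicAinftyOn Q (volume.withDensity σ) (ainftyConst K p₁) := by
  intro R hR hRQ E hER hE hvol
  have hRm := hR.measurableSet
  have hdm : MeasurableSet (R \ E) := hRm.diff hE
  rw [withDensity_apply _ hE, withDensity_apply _ hRm]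
  have hvR : volume R ≤ 2 * volume (R \ E) := by
    have hadd : volume E + volume (R \ E) = volume R := by
      rw [← measure_inter_add_sdiff R hE, Set.inter_eq_right.2 hER]
    refine (ENNReal.add_le_add_iff_left hR.volume_ne_top).1 ?_
    calc volume R + volume R = 2 * volume E + 2 * volume (R \ E) := by
          rw [← mul_add, hadd, two_mul]
      _ ≤ _ := by gcongr
  have hsplit : (∫⁻ x in E, σ x) + ∫⁻ x in R \ E, σ x = ∫⁻ x in R, σ x := by
    rw [← lintegral_inter_add_sdiff σ R hE, Set.inter_eq_right.2 hER]
  set S := ∫⁻ x in R, σ x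
  set S' := ∫⁻ x in R \ E, σ x
  set L := (2 * K) ^ p₁⁻¹ with hL
  have hprod : (∫⁻ x in R, f x) ^ p₀ * S ^ p₁ * (∫⁻ x in R, τ x) ^ p₂ ≤ K * volume R := by
    rw [← setAvg_mul_volume hR f, ← setAvg_mul_volume hR τ,
      show S = setAvg R σ * volume R from (setAvg_mul_volume hR σ).symm,
      ENNReal.mul_rpow_of_nonneg _ _ hp₀.le, ENNReal.mul_rpow_of_nonneg _ _ hp₁.le,
      ENNReal.mul_rpow_of_nonneg _ _ hp₂.le]
    calc _ = setAvg R f ^ p₀ * setAvg R σ ^ p₁ * setAvg R τ ^ p₂ *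
          (volume R ^ p₀ * volume R ^ p₁ * volume R ^ p₂) := by ring
      _ = setAvg R f ^ p₀ * setAvg R σ ^ p₁ * setAvg R τ ^ p₂ * volume R := by
        rw [← ENNReal.rpow_add _ _ hR.volume_ne_zero hR.volume_ne_top,
          ← ENNReal.rpow_add _ _ hR.volume_ne_zero hR.volume_ne_top, hp, ENNReal.rpow_one]
      _ ≤ _ := by gcongr; exact hK R hR
  have hholder := setLIntegral_one_le_of_holder hdm hf hσ hτ hp₀ hp₁ hp₂ hp
    (h.mono fun x hx hxE => hx (hRQ hxE.1))
  have hpow : S ^ p₁ ≤ 2 * K * S' ^ p₁ := by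
    rw [← ENNReal.mul_le_mul_iff_left hR.volume_ne_zero hR.volume_ne_top]
    calc S ^ p₁ * volume R ≤ S ^ p₁ * (2 * volume (R \ E)) := by gcongr
      _ ≤ S ^ p₁ * (2 * ((∫⁻ x in R, f x) ^ p₀ * S' ^ p₁ * (∫⁻ x in R, τ x) ^ p₂)) := by
        gcongr
        refine hholder.trans ?_
        gcongr <;> exact Set.sdiff_subset
      _ = 2 * S' ^ p₁ * ((∫⁻ x in R, f x) ^ p₀ * S ^ p₁ * (∫⁻ x in R, τ x) ^ p₂) := by ring
      _ ≤ 2 * S' ^ p₁ * (K * volume R) := by gcongr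
      _ = _ := by ring
  have hSL : S ≤ L * S' := by
    rw [← ENNReal.rpow_le_rpow_iff hp₁, ENNReal.mul_rpow_of_nonneg _ _ hp₁.le, hL,
      ENNReal.rpow_inv_rpow hp₁.ne']
    exact hpow
  have hLtop : L ≠ ∞ :=
    ENNReal.rpow_ne_top_of_nonneg (by positivity) (ENNReal.mul_ne_top (by simp) hKtop)
  rw [ainftyConst, ← hL, ENNReal.mul_comm_div, ← mul_div_assoc, mul_comm,
    ENNReal.le_div_iff_mul_le (by simp) (by simp [hLtop]), mul_add, mul_one]
  calc (∫⁻ x in E, σ x) * L + ∫⁻ x in E, σ x ≤ (∫⁻ x in E, σ x) * L + L * S' := by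
        gcongr
        exact (le_self_add.trans hsplit.le).trans hSL
    _ = S * L := by rw [← hsplit]; ring

end Holder

section Exponents

lemma bump_exponent {q r a : ℝ} (hr : 0 < r) (ha : 1 < a) (haq : a < q / r) :
    r / q * conjExp (q / (a * r)) = r / (q - r) * (1 + (a - 1) * r / (q - a * r)) := by
  have h1 : a * r < q := (lt_div_iff₀ hr).1 haq
  have h2 : r < a * r := lt_mul_of_one_lt_left hr ha
  have h3 : q - a * r ≠ 0 := by linarith
  have h4 : q - r ≠ 0 := by linarith
  have h5 : q ≠ 0 := by linarith
  have h6 : a ≠ 0 := by linarith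
  have h7 : q / (a * r) - 1 = (q - a * r) / (a * r) := by field_simp
  rw [conjExp, h7, one_add_div h3, show q - a * r + (a - 1) * r = q - r by ring]
  field_simp

lemma bump_outer_exponent {q r a : ℝ} (hr : 0 < r) (ha : 1 < a) (haq : a < q / r) :
    0 < 1 / (r * conjExp (q / (a * r))) ∧
    (1 + (a - 1) * r / (q - a * r)) * (1 / (r * conjExp (q / (a * r)))) =
      (q - r) / (r * q) := by
  have h1 : a * r < q := (lt_div_iff₀ hr).1 haq
  have h2 : r < a * r := lt_mul_of_one_lt_left hr ha
  have h3 : 0 < q - a * r := by linarith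
  have h5 : 0 < q := by linarith
  have h6 : 0 < a := by linarith
  have h7 : q / (a * r) - 1 = (q - a * r) / (a * r) := by field_simp
  rw [conjExp, h7]
  constructor
  · positivity
  · field_simp
    ring

lemma eventually_bump {q r : ℝ} (hr : 0 < r) (hrq : r < q) {A η : ℝ≥0∞} (hA0 : A ≠ 0)
    (hA : A ≠ ∞) (hη : η < 1) :
    ∀ᶠ a in nhdsWithin (1 : ℝ) (Set.Ioi 1),
      a < q / r ∧ A ^ ((a - 1) * r / (q - a * r)) * η < 1 := by
  have hlt : ∀ᶠ a in nhds (1 : ℝ), a < q / r := eventually_lt_nhds ((one_lt_div hr).2 hrq)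
  have hε : ContinuousAt (fun a : ℝ => (a - 1) * r / (q - a * r)) 1 := by
    refine ContinuousAt.div (by fun_prop) (by fun_prop) ?_
    linarith
  have hpow : ContinuousAt (fun a : ℝ => A ^ ((a - 1) * r / (q - a * r)) * η) 1 := by
    lift A to NNReal using hA
    have hA0' : A ≠ 0 := by simpa using hA0
    simp_rw [← ENNReal.coe_rpow_of_ne_zero hA0']
    refine ENNReal.Tendsto.mul_const ?_ (Or.inr (hη.trans ENNReal.one_lt_top).ne)
    refine ENNReal.tendsto_coe.2 ?_
    exact ContinuousAt.comp (f := fun a : ℝ => (A, (a - 1) * r / (q - a * r))) (x := 1)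
      (g := fun p : NNReal × ℝ => p.1 ^ p.2) (NNReal.continuousAt_rpow (Or.inl hA0'))
      (ContinuousAt.prodMk continuousAt_const hε)
  have hev := hpow.eventually_lt_const (u := 1) (by simpa using hη)
  exact (hlt.and hev).filter_mono nhdsWithin_le_nhds

end Exponents

lemma setAvg_bump_le {n : ℕ} (hn : 0 < n) {Q : Set (EuclideanSpace ℝ (Fin n))}
    (hQ : IsDyadicCube Q) {u : EuclideanSpace ℝ (Fin n) → ℝ≥0∞} (hu : Measurable u) {q r a : ℝ}
    (hr : 0 < r) (ha : 1 < a) (haq : a < q / r) {η : ℝ≥0∞}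
    (hη : IsDyadicAinftyOn Q (volume.withDensity fun x => u x ^ (-(r / (q - r)))) η)
    (h0 : setAvg Q (fun x => u x ^ (-(r / (q - r)))) ≠ 0)
    (hfin : setAvg Q (fun x => u x ^ (-(r / (q - r)))) ≠ ∞) :
    setAvg Q (fun x => u x ^ (-(r / q * conjExp (q / (a * r))))) ^
        (1 / (r * conjExp (q / (a * r)))) ≤
      rhConst n η ((a - 1) * r / (q - a * r)) ^ (1 / (r * conjExp (q / (a * r)))) *
        setAvg Q (fun x => u x ^ (-(r / (q - r)))) ^ ((q - r) / (r * q)) := by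
  obtain ⟨he, hmul⟩ := bump_outer_exponent hr ha haq
  have h1 : a * r < q := (lt_div_iff₀ hr).1 haq
  have hε : 0 < (a - 1) * r / (q - a * r) :=
    div_pos (mul_pos (by linarith) hr) (by linarith)
  have hle := setAvg_rpow_le hn hQ (hu.pow_const _) hη h0 hfin hε
  simp_rw [← ENNReal.rpow_mul, neg_mul, ← bump_exponent hr ha haq] at hle
  refine (ENNReal.rpow_le_rpow hle he.le).trans_eq ?_
  rw [ENNReal.mul_rpow_of_nonneg _ _ he.le, ← ENNReal.rpow_mul, hmul]

lemma setAvg_bump_eq_zero {n : ℕ} {Q : Set (EuclideanSpace ℝ (Fin n))}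
    (hQ : IsDyadicCube Q) {u : EuclideanSpace ℝ (Fin n) → ℝ≥0∞} (hu : Measurable u) {q r a : ℝ}
    (hr : 0 < r) (ha : 1 < a) (haq : a < q / r)
    (h0 : setAvg Q (fun x => u x ^ (-(r / (q - r)))) = 0) :
    setAvg Q (fun x => u x ^ (-(r / q * conjExp (q / (a * r))))) ^
        (1 / (r * conjExp (q / (a * r)))) = 0 := by
  obtain ⟨he, -⟩ := bump_outer_exponent hr ha haq
  have h1 : a * r < q := (lt_div_iff₀ hr).1 haq
  have hε : 0 < 1 + (a - 1) * r / (q - a * r) :=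
    add_pos one_pos (div_pos (mul_pos (by linarith) hr) (by linarith))
  have := setAvg_rpow_eq_zero hQ (hu.pow_const _) h0 hε
  simp_rw [← ENNReal.rpow_mul, neg_mul, ← bump_exponent hr ha haq] at this
  rw [this, ENNReal.zero_rpow_of_pos he]

/-- The pointwise duality between `u₁ ^ (s / q₁) * u₂ ^ (s / q₂)` and the dual weights. -/
lemma product_rpow_eq_one {v₁ v₂ : ℝ≥0∞} {b₁ b₂ c₁ c₂ p₀ p₁ p₂ : ℝ} (hb₁ : 0 < b₁) (hb₂ : 0 < b₂)
    (hc₁ : 0 < c₁) (hc₂ : 0 < c₂) (hp₀ : 0 < p₀) (h₁ : c₁ * p₀ = b₁ * p₁) (h₂ : c₂ * p₀ = b₂ * p₂)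
    (hf : v₁ ^ c₁ * v₂ ^ c₂ ≠ ∞) (hσ₁ : v₁ ^ (-b₁) ≠ ∞) (hσ₂ : v₂ ^ (-b₂) ≠ ∞) :
    (v₁ ^ c₁ * v₂ ^ c₂) ^ p₀ * (v₁ ^ (-b₁)) ^ p₁ * (v₂ ^ (-b₂)) ^ p₂ = 1 := by
  have hv₁ : v₁ ≠ 0 := by
    rintro rfl
    exact hσ₁ (ENNReal.zero_rpow_of_neg (by linarith))
  have hv₂ : v₂ ≠ 0 := by
    rintro rfl
    exact hσ₂ (ENNReal.zero_rpow_of_neg (by linarith))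
  have hv₁' : v₁ ≠ ∞ := by
    rintro rfl
    refine hf ?_
    rw [ENNReal.top_rpow_of_pos hc₁, ENNReal.top_mul]
    simp [ENNReal.rpow_eq_zero_iff, hv₂, hc₂.not_gt]
  have hv₂' : v₂ ≠ ∞ := by
    rintro rfl
    refine hf ?_
    rw [ENNReal.top_rpow_of_pos hc₂, ENNReal.mul_top]
    simp [ENNReal.rpow_eq_zero_iff, hv₁, hc₁.not_gt]
  rw [ENNReal.mul_rpow_of_nonneg _ _ hp₀.le]
  simp_rw [← ENNReal.rpow_mul]
  calc _ = v₁ ^ (c₁ * p₀) * v₁ ^ (-b₁ * p₁) * (v₂ ^ (c₂ * p₀) * v₂ ^ (-b₂ * p₂)) := by ring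
    _ = 1 := by
      rw [← ENNReal.rpow_add _ _ hv₁ hv₁', ← ENNReal.rpow_add _ _ hv₂ hv₂', h₁, h₂]
      simp

/-- Self-improvement of the vector two-weight condition `[u₁,u₂]_{q⃗}^s < ∞` (Section 9 of
the paper): it implies the `a`-bumped condition for some `1 < a < min(q₁/r₁, q₂/r₂)`. -/
theorem vector_weight_condition_self_improves
    (n : ℕ) (hn : 0 < n) (q q₁ q₂ r₁ r₂ s : ℝ)
    (hq₁ : 1 < q₁) (hq₂ : 1 < q₂)
    (hr₁ : 0 < r₁) (hr₁q : r₁ < q₁) (hr₂ : 0 < r₂) (hr₂q : r₂ < q₂)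
    (hq : 1 / q = 1 / q₁ + 1 / q₂) (hqs : q ≤ s)
    (u₁ u₂ : EuclideanSpace ℝ (Fin n) → ℝ≥0∞)
    (hu₁ : Measurable u₁) (hu₂ : Measurable u₂)
    (hW : (⨆ (Q : Set (EuclideanSpace ℝ (Fin n))) (_ : IsDyadicCube Q),
        (setAvg Q fun x => u₁ x ^ (s / q₁) * u₂ x ^ (s / q₂)) ^ (1 / s) *
          (setAvg Q fun x => u₁ x ^ (-(r₁ / (q₁ - r₁)))) ^ ((q₁ - r₁) / (r₁ * q₁)) *
          (setAvg Q fun x => u₂ x ^ (-(r₂ / (q₂ - r₂)))) ^ ((q₂ - r₂) / (r₂ * q₂))) ≠ ∞) :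
    ∃ a : ℝ, 1 < a ∧ a < min (q₁ / r₁) (q₂ / r₂) ∧
      (⨆ (Q : Set (EuclideanSpace ℝ (Fin n))) (_ : IsDyadicCube Q),
        (setAvg Q fun x => u₁ x ^ (s / q₁) * u₂ x ^ (s / q₂)) ^ (1 / s) *
          (setAvg Q fun x => u₁ x ^ (-(r₁ / q₁ * conjExp (q₁ / (a * r₁))))) ^
            (1 / (r₁ * conjExp (q₁ / (a * r₁)))) *
          (setAvg Q fun x => u₂ x ^ (-(r₂ / q₂ * conjExp (q₂ / (a * r₂))))) ^
            (1 / (r₂ * conjExp (q₂ / (a * r₂))))) ≠ ∞ := by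
  have hq₁0 : 0 < q₁ := by linarith
  have hq₂0 : 0 < q₂ := by linarith
  have hq0 : 0 < q := by
    rw [← one_div_pos, hq]
    positivity
  have hs : 0 < s := hq0.trans_le hqs
  have hd₁ : 0 < q₁ - r₁ := sub_pos.2 hr₁q
  have hd₂ : 0 < q₂ - r₂ := sub_pos.2 hr₂q
  set K₀ := ⨆ (Q : Set (EuclideanSpace ℝ (Fin n))) (_ : IsDyadicCube Q),
    (setAvg Q fun x => u₁ x ^ (s / q₁) * u₂ x ^ (s / q₂)) ^ (1 / s) *
      (setAvg Q fun x => u₁ x ^ (-(r₁ / (q₁ - r₁)))) ^ ((q₁ - r₁) / (r₁ * q₁)) *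
      (setAvg Q fun x => u₂ x ^ (-(r₂ / (q₂ - r₂)))) ^ ((q₂ - r₂) / (r₂ * q₂)) with hK₀
  set f := fun x => u₁ x ^ (s / q₁) * u₂ x ^ (s / q₂) with hf
  set σ₁ := fun x => u₁ x ^ (-(r₁ / (q₁ - r₁))) with hσ₁
  set σ₂ := fun x => u₂ x ^ (-(r₂ / (q₂ - r₂))) with hσ₂
  set α₁ := (q₁ - r₁) / (r₁ * q₁) with hα₁
  set α₂ := (q₂ - r₂) / (r₂ * q₂) with hα₂
  have hα₁0 : 0 < α₁ := by positivity
  have hα₂0 : 0 < α₂ := by positivity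
  have hfm : Measurable f := (hu₁.pow_const _).mul (hu₂.pow_const _)
  have hσ₁m : Measurable σ₁ := hu₁.pow_const _
  have hσ₂m : Measurable σ₂ := hu₂.pow_const _
  have hQK : ∀ R, IsDyadicCube R →
      setAvg R f ^ (1 / s) * setAvg R σ₁ ^ α₁ * setAvg R σ₂ ^ α₂ ≤ K₀ :=
    fun R hR => le_iSup₂_of_le R hR le_rfl
  set θ := (1 / s + α₁ + α₂)⁻¹ with hθ
  have hsum : 0 < 1 / s + α₁ + α₂ := by positivity
  have hθ0 : 0 < θ := inv_pos.2 hsum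
  have hp : 1 / s * θ + α₁ * θ + α₂ * θ = 1 := by
    rw [← add_mul, ← add_mul, hθ, mul_inv_cancel₀ hsum.ne']
  have hKpow : K₀ ^ θ ≠ ∞ := ENNReal.rpow_ne_top_of_nonneg hθ0.le hW
  have hQKθ : ∀ R, IsDyadicCube R →
      setAvg R f ^ (1 / s * θ) * setAvg R σ₁ ^ (α₁ * θ) * setAvg R σ₂ ^ (α₂ * θ) ≤ K₀ ^ θ := by
    intro R hR
    have := ENNReal.rpow_le_rpow (hQK R hR) hθ0.le
    rwa [ENNReal.mul_rpow_of_nonneg _ _ hθ0.le, ENNReal.mul_rpow_of_nonneg _ _ hθ0.le,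
      ← ENNReal.rpow_mul, ← ENNReal.rpow_mul, ← ENNReal.rpow_mul] at this
  set η₁ := ainftyConst (K₀ ^ θ) (α₁ * θ)
  set η₂ := ainftyConst (K₀ ^ θ) (α₂ * θ)
  have hη₁ : η₁ < 1 := ainftyConst_lt_one hKpow (by positivity)
  have hη₂ : η₂ < 1 := ainftyConst_lt_one hKpow (by positivity)
  obtain ⟨a, ⟨⟨ha₁, hA₁⟩, ha₂, hA₂⟩, ha : 1 < a⟩ :=
    (((eventually_bump hr₁ hr₁q (A := 2 ^ (n + 1)) (by simp) (by simp) hη₁).and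
      (eventually_bump hr₂ hr₂q (A := 2 ^ (n + 1)) (by simp) (by simp) hη₂)).and
      self_mem_nhdsWithin).exists
  refine ⟨a, ha, lt_min ha₁ ha₂, ?_⟩
  obtain ⟨he₁, -⟩ := bump_outer_exponent hr₁ ha ha₁
  obtain ⟨he₂, -⟩ := bump_outer_exponent hr₂ ha ha₂
  have hε₁ : 0 ≤ (a - 1) * r₁ / (q₁ - a * r₁) :=
    div_nonneg (mul_nonneg (by linarith) hr₁.le) (by linarith [(lt_div_iff₀ hr₁).1 ha₁])
  have hε₂ : 0 ≤ (a - 1) * r₂ / (q₂ - a * r₂) :=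
    div_nonneg (mul_nonneg (by linarith) hr₂.le) (by linarith [(lt_div_iff₀ hr₂).1 ha₂])
  set C₁ := rhConst n η₁ ((a - 1) * r₁ / (q₁ - a * r₁)) ^ (1 / (r₁ * conjExp (q₁ / (a * r₁))))
  set C₂ := rhConst n η₂ ((a - 1) * r₂ / (q₂ - a * r₂)) ^ (1 / (r₂ * conjExp (q₂ / (a * r₂))))
  have hC₁ : C₁ ≠ ∞ := ENNReal.rpow_ne_top_of_nonneg he₁.le (rhConst_ne_top hA₁ hε₁)
  have hC₂ : C₂ ≠ ∞ := ENNReal.rpow_ne_top_of_nonneg he₂.le (rhConst_ne_top hA₂ hε₂)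
  refine ne_top_of_le_ne_top (ENNReal.mul_ne_top (ENNReal.mul_ne_top hC₁ hC₂) hW)
    (iSup₂_le fun Q hQ => ?_)
  by_cases hF0 : setAvg Q f = 0
  · rw [hF0, ENNReal.zero_rpow_of_pos (by positivity)]
    simp
  by_cases hS₁0 : setAvg Q σ₁ = 0
  · rw [setAvg_bump_eq_zero hQ hu₁ hr₁ ha ha₁ hS₁0]
    simp
  by_cases hS₂0 : setAvg Q σ₂ = 0
  · rw [setAvg_bump_eq_zero hQ hu₂ hr₂ ha ha₂ hS₂0]
    simp
  have hFs : setAvg Q f ^ (1 / s) ≠ 0 := by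
    simp [ENNReal.rpow_eq_zero_iff, hF0, hs.not_gt]
  have hS₁α : setAvg Q σ₁ ^ α₁ ≠ 0 := by
    simp [ENNReal.rpow_eq_zero_iff, hS₁0, hα₁0.not_gt]
  have hS₂α : setAvg Q σ₂ ^ α₂ ≠ 0 := by
    simp [ENNReal.rpow_eq_zero_iff, hS₂0, hα₂0.not_gt]
  have hprod := ne_top_of_le_ne_top hW (hQK Q hQ)
  have hFt : setAvg Q f ≠ ∞ := by
    intro h
    rw [h, ENNReal.top_rpow_of_pos (by positivity), ENNReal.top_mul hS₁α,
      ENNReal.top_mul hS₂α] at hprod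
    exact hprod rfl
  have hS₁t : setAvg Q σ₁ ≠ ∞ := by
    intro h
    rw [h, ENNReal.top_rpow_of_pos hα₁0, ENNReal.mul_top hFs, ENNReal.top_mul hS₂α] at hprod
    exact hprod rfl
  have hS₂t : setAvg Q σ₂ ≠ ∞ := by
    intro h
    rw [h, ENNReal.top_rpow_of_pos hα₂0, ENNReal.mul_top (mul_ne_zero hFs hS₁α)] at hprod
    exact hprod rfl
  have hpt : ∀ᵐ x, x ∈ Q → f x ^ (1 / s * θ) * σ₁ x ^ (α₁ * θ) * σ₂ x ^ (α₂ * θ) = 1 := by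
    rw [← ae_restrict_iff' hQ.measurableSet]
    filter_upwards [ae_lt_top hfm (lintegral_ne_top_of_setAvg_ne_top hQ hFt),
      ae_lt_top hσ₁m (lintegral_ne_top_of_setAvg_ne_top hQ hS₁t),
      ae_lt_top hσ₂m (lintegral_ne_top_of_setAvg_ne_top hQ hS₂t)] with x hx hx₁ hx₂
    refine product_rpow_eq_one (by positivity) (by positivity) (by positivity) (by positivity)
      (by positivity) ?_ ?_ hx.ne hx₁.ne hx₂.ne
    · rw [hα₁]
      field_simp
    · rw [hα₂]
      field_simp
  have hA₁Q : IsDyadicAinftyOn Q (volume.withDensity σ₁) η₁ :=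
    isDyadicAinftyOn_of_product hfm hσ₁m hσ₂m (by positivity) (by positivity) (by positivity) hp
      (hpt.mono fun x hx hxQ => (hx hxQ).ge) hQKθ hKpow
  have hA₂Q : IsDyadicAinftyOn Q (volume.withDensity σ₂) η₂ :=
    isDyadicAinftyOn_of_product hfm hσ₂m hσ₁m (by positivity) (by positivity) (by positivity)
      ((add_right_comm _ _ _).trans hp)
      (hpt.mono fun x hx hxQ => ((mul_right_comm _ _ _).trans (hx hxQ)).ge)
      (fun R hR => (mul_right_comm _ _ _).trans_le (hQKθ R hR)) hKpow
  calc _ ≤ setAvg Q f ^ (1 / s) * (C₁ * setAvg Q σ₁ ^ α₁) * (C₂ * setAvg Q σ₂ ^ α₂) := by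
        gcongr
        · exact setAvg_bump_le hn hQ hu₁ hr₁ ha ha₁ hA₁Q hS₁0 hS₁t
        · exact setAvg_bump_le hn hQ hu₂ hr₂ ha ha₂ hA₂Q hS₂0 hS₂t
    _ = C₁ * C₂ * (setAvg Q f ^ (1 / s) * setAvg Q σ₁ ^ α₁ * setAvg Q σ₂ ^ α₂) := by ring
    _ ≤ C₁ * C₂ * K₀ := by
        gcongr
        exact hQK Q hQ
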